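/- Let g : ℝ² → ℝ be sufficiently smooth with L(∂_x g) not identically zero, let κ ∈ ℝ, and let λ ∈ C¹(I). If the function u(t,x,y) := g(x − λ(t), y) satisfies −L(λ̇(t) u_x) + κ u_{xx} + (3 u u_x − 2 u_x u_{xx} − u u_{xxx})_x + u_{yy} = 0 for all (t,x,y) ∈ I × ℝ², then λ̇ is constant on I; that is, there exists c ∈ ℝ with λ̇(t) = c for all t ∈ I. -/

import Mathlib

open Set

/-- Partial derivative in the time variable `t` of a function `u(t,x,y)`. -/
noncomputable def pt (u : ℝ → ℝ → ℝ → ℝ) : ℝ → ℝ → ℝ → ℝ :=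
  fun t x y => deriv (fun s => u s x y) t

/-- Partial derivative in the horizontal variable `x` of a function `u(t,x,y)`. -/
noncomputable def px (u : ℝ → ℝ → ℝ → ℝ) : ℝ → ℝ → ℝ → ℝ :=
  fun t x y => deriv (fun s => u t s y) x

/-- Partial derivative in the transversal variable `y` of a function `u(t,x,y)`. -/
noncomputable def py (u : ℝ → ℝ → ℝ → ℝ) : ℝ → ℝ → ℝ → ℝ :=
  fun t x y => deriv (fun s => u t x s) y

/-- The operator `L f = ∂ₓ(1 - ∂ₓ²) f = fₓ - fₓₓₓ`, acting in the `x`-variable. -/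
noncomputable def Lx (u : ℝ → ℝ → ℝ → ℝ) : ℝ → ℝ → ℝ → ℝ :=
  fun t x y => px u t x y - px (px (px u)) t x y
/-- The nonlinearity `3 u uₓ - 2 uₓ uₓₓ - u uₓₓₓ` of the CH-KP equation. -/
noncomputable def chkpNonlin (u : ℝ → ℝ → ℝ → ℝ) : ℝ → ℝ → ℝ → ℝ :=
  fun t x y =>
    3 * u t x y * px u t x y - 2 * px u t x y * px (px u) t x y
      - u t x y * px (px (px u)) t x y

/-- Partial derivative in the first variable of a function `g(x,y)` of two variables. -/
noncomputable def pdx (g : ℝ → ℝ → ℝ) : ℝ → ℝ → ℝ :=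
  fun x y => deriv (fun s => g s y) x

/-- The operator `L g = gₓ - gₓₓₓ` for functions of two variables `(x,y)`. -/
noncomputable def L2op (g : ℝ → ℝ → ℝ) : ℝ → ℝ → ℝ :=
  fun x y => pdx g x y - pdx (pdx (pdx g)) x y

theorem px_comp_sub (h : ℝ → ℝ → ℝ) (lam : ℝ → ℝ) :
    px (fun t x y => h (x - lam t) y) = fun t x y => pdx h (x - lam t) y := by
  funext t x y
  exact deriv_comp_sub_const (f := fun s => h s y) (lam t) x

theorem px_mul_left (a : ℝ → ℝ) (v : ℝ → ℝ → ℝ → ℝ) :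
    px (fun t x y => a t * v t x y) = fun t x y => a t * px v t x y := by
  funext t x y
  exact deriv_const_mul_field (a t)

theorem Lx_mul_comp_sub (h : ℝ → ℝ → ℝ) (a lam : ℝ → ℝ) (t x y : ℝ) :
    Lx (fun t x y => a t * h (x - lam t) y) t x y = a t * L2op h (x - lam t) y := by
  simp only [Lx, L2op, px_mul_left, px_comp_sub]
  ring

/-- If `u(t,x,y) = g(x - λ(t), y)` satisfies
`-L(λ̇ uₓ) + κ uₓₓ + (3 u uₓ - 2 uₓ uₓₓ - u uₓₓₓ)ₓ + u_yy = 0` on `[0,T] × ℝ²` and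
`L(∂ₓ g)` is not identically zero, then `λ̇` is constant on `[0,T]`. -/
theorem chkp_wave_speed_constant
    (T : ℝ) (hT : 0 < T) (κ : ℝ)
    (g : ℝ → ℝ → ℝ) (hg : ContDiff ℝ (⊤ : ℕ∞) (fun p : ℝ × ℝ => g p.1 p.2))
    (hnontriv : ¬ (∀ x y : ℝ, L2op (pdx g) x y = 0))
    (lam : ℝ → ℝ) (hlam : ContDiff ℝ 1 lam)
    (u : ℝ → ℝ → ℝ → ℝ) (hudef : u = fun t x y => g (x - lam t) y)
    (heq : ∀ t ∈ Icc (0:ℝ) T, ∀ x y : ℝ,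
      - Lx (fun s a b => deriv lam s * px u s a b) t x y + κ * px (px u) t x y
        + px (chkpNonlin u) t x y + py (py u) t x y = 0) :
    ∃ c : ℝ, ∀ t ∈ Icc (0:ℝ) T, deriv lam t = c := by
  obtain ⟨x₀, y₀, h₀⟩ : ∃ x y, L2op (pdx g) x y ≠ 0 := by
    simpa only [not_forall] using hnontriv
  subst hudef
  let N : ℝ → ℝ → ℝ := fun x y =>
    3 * g x y * pdx g x y - 2 * pdx g x y * pdx (pdx g) x y - g x y * pdx (pdx (pdx g)) x y
  have hN : chkpNonlin (fun t x y => g (x - lam t) y) = fun t x y => N (x - lam t) y := by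
    funext t x y
    simp only [chkpNonlin, px_comp_sub, N]
  refine ⟨(κ * pdx (pdx g) x₀ y₀ + pdx N x₀ y₀ + deriv (fun s => deriv (g x₀) s) y₀)
    / L2op (pdx g) x₀ y₀, fun t ht => ?_⟩
  have h := heq t ht (x₀ + lam t) y₀
  simp only [hN, px_comp_sub, Lx_mul_comp_sub, py, add_sub_cancel_right] at h
  rw [eq_div_iff h₀]
  linarith
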